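/- arXiv:2205.11970 — 5 statements merged into one kernel-verified Lean document; each statement's English description precedes it below -/
import Mathlib

section
/- Let d ≥ 1 be an integer and m, b, M, β > 0. The function f is nonnegative and bounded on [0, ∞) with f(0) = 0; f is continuous, nondecreasing and concave on all of ℝ; and for every r with 0 ≤ r ≤ R₂ one has the chain of inequalities r·φ(R₂) ≤ Φ(r) ≤ 2 f(r) ≤ 2 Φ(r) ≤ 2 r. -/
open MeasureTheory Real RealInnerProductSpace

noncomputable section

def Vbar {d : ℕ} (x : EuclideanSpace ℝ (Fin d)) : ℝ := 1 + ‖x‖ ^ 2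

def Cc (d : ℕ) (m b β : ℝ) : ℝ := 2 * ((d : ℝ) / β + b) + m

def S1 (d : ℕ) (m b β : ℝ) : Set (EuclideanSpace ℝ (Fin d) × EuclideanSpace ℝ (Fin d)) :=
  {p | Vbar p.1 + Vbar p.2 ≤ 2 * Cc d m b β / m}

def S2 (d : ℕ) (m b β : ℝ) : Set (EuclideanSpace ℝ (Fin d) × EuclideanSpace ℝ (Fin d)) :=
  {p | Vbar p.1 + Vbar p.2 ≤ 4 * Cc d m b β * (1 + 1 / m)}

def R1 (d : ℕ) (m b β : ℝ) : ℝ := Metric.diam (S1 d m b β)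

def R2 (d : ℕ) (m b β : ℝ) : ℝ := Metric.diam (S2 d m b β)

def kappa (d : ℕ) (m b M β : ℝ) : ℝ :=
  min (1 / 2)
    (2 / (Cc d m b β * β * (Real.exp (2 * R1 d m b β) - 1 - 2 * R1 d m b β)) *
      Real.exp (-(M * β * R1 d m b β ^ 2 / 8)))

def Qk (d : ℕ) (m b M β : ℝ) : ℝ :=
  2 * Real.sqrt (kappa d m b M β - kappa d m b M β ^ 2)

def phi (d : ℕ) (m b M β : ℝ) (r : ℝ) : ℝ :=
  Real.exp (-(M * β / 8) * r ^ 2 - 2 * Qk d m b M β * r)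

def Phi (d : ℕ) (m b M β : ℝ) (r : ℝ) : ℝ :=
  ∫ s in (0:ℝ)..r, phi d m b M β s

def zeta (d : ℕ) (m b M β : ℝ) : ℝ :=
  (∫ s in (0:ℝ)..(R2 d m b β), Phi d m b M β s * (phi d m b M β s)⁻¹)⁻¹

def xi (d : ℕ) (m b M β : ℝ) : ℝ :=
  (∫ s in (0:ℝ)..(R1 d m b β), Phi d m b M β s * (phi d m b M β s)⁻¹)⁻¹

def gfun (d : ℕ) (m b M β : ℝ) (r : ℝ) : ℝ :=
  1 - zeta d m b M β / 4 *
      (∫ s in (0:ℝ)..(min r (R2 d m b β)), Phi d m b M β s * (phi d m b M β s)⁻¹)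
    - xi d m b M β / 4 *
      (∫ s in (0:ℝ)..(min r (R1 d m b β)), Phi d m b M β s * (phi d m b M β s)⁻¹)

def ffun (d : ℕ) (m b M β : ℝ) (r : ℝ) : ℝ :=
  if r < 0 then r else ∫ s in (0:ℝ)..(min r (R2 d m b β)), phi d m b M β s * gfun d m b M β s

theorem monotone_intervalIntegral_of_nonneg {k : ℝ → ℝ} (hk : Continuous k) (h0 : ∀ s, 0 ≤ k s) :
    Monotone fun r => ∫ s in (0:ℝ)..r, k s := by
  intro x y hxy
  have h := intervalIntegral.integral_add_adjacent_intervals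
    (hk.intervalIntegrable (μ := volume) 0 x) (hk.intervalIntegrable x y)
  have h' : 0 ≤ ∫ s in x..y, k s := intervalIntegral.integral_nonneg hxy fun s _ => h0 s
  simp only
  linarith

theorem concaveOn_intervalIntegral_of_antitone {k : ℝ → ℝ} (hk : Continuous k) (hanti : Antitone k) :
    ConcaveOn ℝ Set.univ fun r => ∫ s in (0:ℝ)..r, k s := by
  have hd (x : ℝ) : HasDerivAt (fun r => ∫ s in (0:ℝ)..r, k s) (k x) x :=
    intervalIntegral.integral_hasDerivAt_right (hk.intervalIntegrable 0 x)
      (hk.stronglyMeasurableAtFilter _ _) hk.continuousAt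
  refine Antitone.concaveOn_univ_of_deriv (fun x => (hd x).differentiableAt) ?_
  rwa [show deriv (fun r => ∫ s in (0:ℝ)..r, k s) = k from funext fun x => (hd x).deriv]

theorem ConcaveOn.comp_min_const {G : ℝ → ℝ} (hG : ConcaveOn ℝ Set.univ G) (hmono : Monotone G)
    (R : ℝ) : ConcaveOn ℝ Set.univ fun r => G (min r R) := by
  have hmin : ConcaveOn ℝ Set.univ fun r : ℝ => min r R :=
    (concaveOn_id convex_univ).inf (concaveOn_const R convex_univ)
  refine ⟨convex_univ, fun x _ y _ a c ha hc hac => ?_⟩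
  exact (hG.2 (Set.mem_univ _) (Set.mem_univ _) ha hc hac).trans
    (hmono (hmin.2 (Set.mem_univ x) (Set.mem_univ y) ha hc hac))

section truncated

variable {h : ℝ → ℝ} {R : ℝ}

theorem intervalIntegral_min_mono (hh : Continuous h) (h0 : ∀ s, 0 ≤ s → 0 ≤ h s)
    (hR : 0 ≤ R) {x y : ℝ} (hx : 0 ≤ x) (hxy : x ≤ y) :
    ∫ s in (0:ℝ)..min x R, h s ≤ ∫ s in (0:ℝ)..min y R, h s := by
  have hle : min x R ≤ min y R := min_le_min_right R hxy
  have h1 := intervalIntegral.integral_add_adjacent_intervals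
    (hh.intervalIntegrable (μ := volume) 0 (min x R)) (hh.intervalIntegrable (min x R) (min y R))
  have h2 : 0 ≤ ∫ s in (min x R)..(min y R), h s :=
    intervalIntegral.integral_nonneg hle fun s hs => h0 s ((le_min hx hR).trans hs.1)
  linarith

theorem inv_intervalIntegral_mul_min_le_one (hh : Continuous h) (h0 : ∀ s, 0 ≤ s → 0 ≤ h s)
    (hR : 0 ≤ R) {x : ℝ} (hx : 0 ≤ x) :
    (∫ s in (0:ℝ)..R, h s)⁻¹ * ∫ s in (0:ℝ)..min x R, h s ≤ 1 := by
  have hI : 0 ≤ ∫ s in (0:ℝ)..R, h s := intervalIntegral.integral_nonneg hR fun s hs => h0 s hs.1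
  have hle := intervalIntegral_min_mono hh h0 hR hx (le_max_left x R)
  rw [min_eq_right (le_max_right x R)] at hle
  rw [mul_comm, ← div_eq_mul_inv]
  exact div_le_one_of_le₀ hle hI

end truncated

section profile

variable (d : ℕ) (m b M β : ℝ)

theorem R1_nonneg : 0 ≤ R1 d m b β := Metric.diam_nonneg

theorem R2_nonneg : 0 ≤ R2 d m b β := Metric.diam_nonneg

theorem phi_pos (r : ℝ) : 0 < phi d m b M β r := Real.exp_pos _

theorem phi_zero : phi d m b M β 0 = 1 := by simp [phi]

theorem continuous_phi : Continuous (phi d m b M β) := by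
  unfold phi
  fun_prop

theorem continuous_Phi : Continuous (Phi d m b M β) :=
  intervalIntegral.continuous_primitive
    (fun x y => (continuous_phi d m b M β).intervalIntegrable x y) 0

theorem Phi_nonneg {r : ℝ} (hr : 0 ≤ r) : 0 ≤ Phi d m b M β r :=
  intervalIntegral.integral_nonneg hr fun s _ => (phi_pos d m b M β s).le

theorem continuous_Phi_mul_inv_phi :
    Continuous fun s => Phi d m b M β s * (phi d m b M β s)⁻¹ :=
  (continuous_Phi d m b M β).mul
    ((continuous_phi d m b M β).inv₀ fun s => (phi_pos d m b M β s).ne')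

theorem Phi_mul_inv_phi_nonneg (s : ℝ) (hs : 0 ≤ s) :
    0 ≤ Phi d m b M β s * (phi d m b M β s)⁻¹ :=
  mul_nonneg (Phi_nonneg d m b M β hs) (inv_nonneg.2 (phi_pos d m b M β s).le)

theorem zeta_nonneg : 0 ≤ zeta d m b M β :=
  inv_nonneg.2 <| intervalIntegral.integral_nonneg (R2_nonneg d m b β)
    fun s hs => Phi_mul_inv_phi_nonneg d m b M β s hs.1

theorem xi_nonneg : 0 ≤ xi d m b M β :=
  inv_nonneg.2 <| intervalIntegral.integral_nonneg (R1_nonneg d m b β)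
    fun s hs => Phi_mul_inv_phi_nonneg d m b M β s hs.1

theorem continuous_gfun : Continuous (gfun d m b M β) := by
  have hprim : Continuous fun r => ∫ s in (0:ℝ)..r, Phi d m b M β s * (phi d m b M β s)⁻¹ :=
    intervalIntegral.continuous_primitive
      (fun x y => (continuous_Phi_mul_inv_phi d m b M β).intervalIntegrable x y) 0
  exact (continuous_const.sub (continuous_const.mul
    (hprim.comp (continuous_id.min continuous_const)))).sub (continuous_const.mul
    (hprim.comp (continuous_id.min continuous_const)))

theorem gfun_zero : gfun d m b M β 0 = 1 := by
  simp [gfun, min_eq_left (R1_nonneg d m b β), min_eq_left (R2_nonneg d m b β)]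

theorem gfun_antitone {x y : ℝ} (hx : 0 ≤ x) (hxy : x ≤ y) :
    gfun d m b M β y ≤ gfun d m b M β x := by
  have h2 := mul_le_mul_of_nonneg_left
    (intervalIntegral_min_mono (continuous_Phi_mul_inv_phi d m b M β)
      (Phi_mul_inv_phi_nonneg d m b M β) (R2_nonneg d m b β) hx hxy)
    (div_nonneg (zeta_nonneg d m b M β) zero_le_four)
  have h1 := mul_le_mul_of_nonneg_left
    (intervalIntegral_min_mono (continuous_Phi_mul_inv_phi d m b M β)
      (Phi_mul_inv_phi_nonneg d m b M β) (R1_nonneg d m b β) hx hxy)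
    (div_nonneg (xi_nonneg d m b M β) zero_le_four)
  unfold gfun
  linarith

theorem gfun_le_one {r : ℝ} (hr : 0 ≤ r) : gfun d m b M β r ≤ 1 :=
  (gfun_antitone d m b M β le_rfl hr).trans (gfun_zero d m b M β).le

theorem half_le_gfun {r : ℝ} (hr : 0 ≤ r) : 1 / 2 ≤ gfun d m b M β r := by
  have h2 := inv_intervalIntegral_mul_min_le_one (continuous_Phi_mul_inv_phi d m b M β)
    (Phi_mul_inv_phi_nonneg d m b M β) (R2_nonneg d m b β) hr
  have h1 := inv_intervalIntegral_mul_min_le_one (continuous_Phi_mul_inv_phi d m b M β)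
    (Phi_mul_inv_phi_nonneg d m b M β) (R1_nonneg d m b β) hr
  unfold gfun zeta xi
  linarith

variable {M β}

theorem phi_antitone (hM : 0 ≤ M) (hβ : 0 ≤ β) {x y : ℝ} (hx : 0 ≤ x) (hxy : x ≤ y) :
    phi d m b M β y ≤ phi d m b M β x := by
  have hQ : 0 ≤ Qk d m b M β := mul_nonneg zero_le_two (Real.sqrt_nonneg _)
  have hsq : M * β / 8 * x ^ 2 ≤ M * β / 8 * y ^ 2 := by gcongr
  have hlin : 2 * Qk d m b M β * x ≤ 2 * Qk d m b M β * y := by gcongr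
  exact Real.exp_le_exp.2 (by linarith)

theorem phi_le_one (hM : 0 ≤ M) (hβ : 0 ≤ β) {r : ℝ} (hr : 0 ≤ r) : phi d m b M β r ≤ 1 :=
  (phi_antitone d m b hM hβ le_rfl hr).trans (phi_zero d m b M β).le

theorem mul_phi_le_Phi (hM : 0 ≤ M) (hβ : 0 ≤ β) {r R : ℝ} (hr : 0 ≤ r) (hrR : r ≤ R) :
    r * phi d m b M β R ≤ Phi d m b M β r := by
  have h := intervalIntegral.integral_mono_on hr (intervalIntegrable_const (c := phi d m b M β R))
    ((continuous_phi d m b M β).intervalIntegrable (μ := volume) 0 r)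
    fun s hs => phi_antitone d m b hM hβ hs.1 (hs.2.trans hrR)
  simpa [Phi] using h

theorem Phi_le_self (hM : 0 ≤ M) (hβ : 0 ≤ β) {r : ℝ} (hr : 0 ≤ r) : Phi d m b M β r ≤ r := by
  have h := intervalIntegral.integral_mono_on hr
    ((continuous_phi d m b M β).intervalIntegrable (μ := volume) 0 r)
    (intervalIntegrable_const (c := (1 : ℝ))) fun s hs => phi_le_one d m b hM hβ hs.1
  simpa [Phi] using h

variable (M β)

/-- The slope `φ g` of `f`, extended by its value `1` at the origin to negative arguments. -/
def fslope (s : ℝ) : ℝ := phi d m b M β (max s 0) * gfun d m b M β (max s 0)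

theorem continuous_fslope : Continuous (fslope d m b M β) :=
  ((continuous_phi d m b M β).comp (continuous_id.max continuous_const)).mul
    ((continuous_gfun d m b M β).comp (continuous_id.max continuous_const))

theorem fslope_nonneg (s : ℝ) : 0 ≤ fslope d m b M β s :=
  mul_nonneg (phi_pos d m b M β _).le
    ((half_le_gfun d m b M β (le_max_right s 0)).trans' (by norm_num))

variable {M β} in
theorem fslope_antitone (hM : 0 ≤ M) (hβ : 0 ≤ β) : Antitone (fslope d m b M β) := by
  intro x y hxy
  have hle : max x 0 ≤ max y 0 := max_le_max_right 0 hxy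
  exact mul_le_mul (phi_antitone d m b hM hβ (le_max_right x 0) hle)
    (gfun_antitone d m b M β (le_max_right x 0) hle)
    ((half_le_gfun d m b M β (le_max_right y 0)).trans' (by norm_num)) (phi_pos d m b M β _).le

theorem ffun_eq_integral_fslope :
    ffun d m b M β = fun r => ∫ s in (0:ℝ)..min r (R2 d m b β), fslope d m b M β s := by
  funext r
  have hR := R2_nonneg d m b β
  unfold ffun
  split_ifs with hr
  · have hs : Set.EqOn (fslope d m b M β) (fun _ => 1) (Set.uIcc 0 r) := fun s hs => by
      rw [Set.uIcc_of_ge hr.le] at hs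
      simp [fslope, max_eq_right hs.2, phi_zero, gfun_zero]
    rw [min_eq_left (hr.le.trans hR), intervalIntegral.integral_congr hs]
    simp
  · refine intervalIntegral.integral_congr fun s hs => ?_
    rw [Set.uIcc_of_le (le_min (not_lt.1 hr) hR)] at hs
    simp [fslope, max_eq_left hs.1]

theorem ffun_eq_integral {r : ℝ} (hr : 0 ≤ r) (hrR : r ≤ R2 d m b β) :
    ffun d m b M β r = ∫ s in (0:ℝ)..r, phi d m b M β s * gfun d m b M β s := by
  rw [ffun, if_neg hr.not_gt, min_eq_left hrR]

theorem ffun_le_Phi {r : ℝ} (hr : 0 ≤ r) (hrR : r ≤ R2 d m b β) :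
    ffun d m b M β r ≤ Phi d m b M β r := by
  rw [ffun_eq_integral d m b M β hr hrR]
  exact intervalIntegral.integral_mono_on hr
    (((continuous_phi d m b M β).mul (continuous_gfun d m b M β)).intervalIntegrable 0 r)
    ((continuous_phi d m b M β).intervalIntegrable 0 r)
    fun s hs => mul_le_of_le_one_right (phi_pos d m b M β s).le (gfun_le_one d m b M β hs.1)

theorem Phi_le_two_mul_ffun {r : ℝ} (hr : 0 ≤ r) (hrR : r ≤ R2 d m b β) :
    Phi d m b M β r ≤ 2 * ffun d m b M β r := by
  rw [ffun_eq_integral d m b M β hr hrR, ← intervalIntegral.integral_const_mul]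
  refine intervalIntegral.integral_mono_on hr
    ((continuous_phi d m b M β).intervalIntegrable 0 r)
    ((continuous_const.mul
      ((continuous_phi d m b M β).mul (continuous_gfun d m b M β))).intervalIntegrable 0 r)
    fun s hs => ?_
  nlinarith [phi_pos d m b M β s, half_le_gfun d m b M β hs.1]

end profile

theorem stmt5 (d : ℕ) (hd : 1 ≤ d) (m b M β : ℝ)
    (hm : 0 < m) (hb : 0 < b) (hM : 0 < M) (hβ : 0 < β) :
    (∀ r : ℝ, 0 ≤ r → 0 ≤ ffun d m b M β r) ∧
    (∃ K : ℝ, ∀ r : ℝ, 0 ≤ r → ffun d m b M β r ≤ K) ∧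
    ffun d m b M β 0 = 0 ∧
    Continuous (ffun d m b M β) ∧
    Monotone (ffun d m b M β) ∧
    ConcaveOn ℝ Set.univ (ffun d m b M β) ∧
    (∀ r : ℝ, 0 ≤ r → r ≤ R2 d m b β →
      r * phi d m b M β (R2 d m b β) ≤ Phi d m b M β r ∧
      Phi d m b M β r ≤ 2 * ffun d m b M β r ∧
      2 * ffun d m b M β r ≤ 2 * Phi d m b M β r ∧
      2 * Phi d m b M β r ≤ 2 * r) := by
  have hk := continuous_fslope d m b M β
  have hR := R2_nonneg d m b β
  have hmono := monotone_intervalIntegral_of_nonneg hk (fslope_nonneg d m b M β)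
  have hconc := concaveOn_intervalIntegral_of_antitone hk (fslope_antitone d m b hM.le hβ.le)
  have hcont : Continuous fun r => ∫ s in (0:ℝ)..r, fslope d m b M β s :=
    intervalIntegral.continuous_primitive (fun x y => hk.intervalIntegrable x y) 0
  have hf := ffun_eq_integral_fslope d m b M β
  have hfmono : Monotone (ffun d m b M β) := by
    rw [hf]
    exact fun x y hxy => hmono (min_le_min_right _ hxy)
  have hf0 : ffun d m b M β 0 = 0 := by simp [ffun, min_eq_left hR]
  refine ⟨fun r hr => hf0.ge.trans (hfmono hr),
    ⟨∫ s in (0:ℝ)..R2 d m b β, fslope d m b M β s, fun r _ => ?_⟩, hf0, ?_, hfmono, ?_,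
    fun r hr hrR => ⟨mul_phi_le_Phi d m b hM.le hβ.le hr hrR,
      Phi_le_two_mul_ffun d m b M β hr hrR, ?_, ?_⟩⟩
  · rw [hf]
    exact hmono (min_le_right _ _)
  · rw [hf]
    exact hcont.comp (continuous_id.min continuous_const)
  · rw [hf]
    exact hconc.comp_min_const hmono _
  · linarith [ffun_le_Phi d m b M β hr hrR]
  · linarith [Phi_le_self d m b hM.le hβ.le hr]

end
end

section
/- Let d ≥ 1 be an integer and m, b, M, β > 0. Then κ ∈ (0, 1) and ∫₀^{R₁} Φ(s) φ(s)⁻¹ ds ≤ 1/(2 C β κ). -/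
open MeasureTheory Real RealInnerProductSpace

noncomputable section

theorem R1_pos {d : ℕ} (hd : 1 ≤ d) {m b β : ℝ} (hm : 0 < m) (hb : 0 < b) (hβ : 0 < β) :
    0 < R1 d m b β := by
  have hc : 0 < 2 * Cc d m b β / m - 2 := by
    have h : 2 * Cc d m b β / m - 2 = 4 * ((d : ℝ) / β + b) / m := by
      unfold Cc
      field_simp
      ring
    rw [h]
    positivity
  have hbdd : Bornology.IsBounded (S1 d m b β) := by
    refine (Metric.isBounded_closedBall (x := 0) (r := 2 * Cc d m b β / m)).subset ?_
    intro p hp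
    have hp' : 1 + ‖p.1‖ ^ 2 + (1 + ‖p.2‖ ^ 2) ≤ 2 * Cc d m b β / m := hp
    rw [mem_closedBall_zero_iff, Prod.norm_def]
    refine max_le ?_ ?_ <;>
      nlinarith [sq_nonneg (‖p.1‖ - 1), sq_nonneg (‖p.2‖ - 1), norm_nonneg p.1, norm_nonneg p.2]
  refine Metric.diam_pos ?_ hbdd
  let v : EuclideanSpace ℝ (Fin d) :=
    EuclideanSpace.single ⟨0, hd⟩ (√(2 * Cc d m b β / m - 2))
  have hv : ‖v‖ = √(2 * Cc d m b β / m - 2) := by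
    simp [v, abs_of_nonneg (Real.sqrt_nonneg _)]
  refine ⟨(v, 0), ?_, (0, 0), ?_, ?_⟩
  · change 1 + ‖v‖ ^ 2 + (1 + ‖(0 : EuclideanSpace ℝ (Fin d))‖ ^ 2) ≤ _
    rw [hv, Real.sq_sqrt hc.le, norm_zero]
    linarith
  · change 1 + ‖(0 : EuclideanSpace ℝ (Fin d))‖ ^ 2
      + (1 + ‖(0 : EuclideanSpace ℝ (Fin d))‖ ^ 2) ≤ _
    rw [norm_zero]
    linarith
  · intro h
    have h0 : v = 0 := congrArg Prod.fst h
    rw [h0, norm_zero] at hv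
    exact (Real.sqrt_pos.2 hc).ne hv

theorem integral_exp_two_mul_sub (s : ℝ) :
    ∫ t in (0 : ℝ)..s, Real.exp (2 * (s - t)) = (Real.exp (2 * s) - 1) / 2 := by
  have h : ∀ t ∈ Set.uIcc 0 s,
      HasDerivAt (fun t => -(Real.exp (2 * (s - t)) / 2)) (Real.exp (2 * (s - t))) t := by
    intro t _
    have h1 : HasDerivAt (fun t : ℝ => 2 * (s - t)) (2 * (-1)) t :=
      ((hasDerivAt_id t).const_sub s).const_mul 2
    exact (h1.exp.div_const 2).neg.congr_deriv (by ring)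
  rw [intervalIntegral.integral_eq_sub_of_hasDerivAt h
    (Continuous.intervalIntegrable (by fun_prop) _ _)]
  simp
  ring

theorem integral_exp_two_mul_sub_one (R : ℝ) :
    ∫ s in (0 : ℝ)..R, (Real.exp (2 * s) - 1) / 2 = (Real.exp (2 * R) - 1 - 2 * R) / 4 := by
  have h : ∀ s ∈ Set.uIcc 0 R,
      HasDerivAt (fun s => (Real.exp (2 * s) / 2 - s) / 2) ((Real.exp (2 * s) - 1) / 2) s := by
    intro s _
    have h1 : HasDerivAt (fun s : ℝ => 2 * s) (2 * 1) s := (hasDerivAt_id s).const_mul 2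
    exact (((h1.exp.div_const 2).sub (hasDerivAt_id s)).div_const 2).congr_deriv (by ring)
  rw [intervalIntegral.integral_eq_sub_of_hasDerivAt h
    (Continuous.intervalIntegrable (by fun_prop) _ _)]
  simp
  ring

theorem integral_primitive_mul_inv_le {a q R : ℝ} (ha : 0 ≤ a) (hq : q ≤ 1) (hR : 0 ≤ R) :
    ∫ s in (0 : ℝ)..R, (∫ t in (0 : ℝ)..s, Real.exp (-a * t ^ 2 - 2 * q * t)) *
        (Real.exp (-a * s ^ 2 - 2 * q * s))⁻¹
      ≤ Real.exp (a * R ^ 2) * ((Real.exp (2 * R) - 1 - 2 * R) / 4) := by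
  have hcont : Continuous fun t : ℝ => Real.exp (-a * t ^ 2 - 2 * q * t) := by fun_prop
  have hprim : Continuous fun s : ℝ => ∫ t in (0 : ℝ)..s, Real.exp (-a * t ^ 2 - 2 * q * t) :=
    intervalIntegral.continuous_primitive (fun _ _ => hcont.intervalIntegrable _ _) 0
  rw [← integral_exp_two_mul_sub_one, ← intervalIntegral.integral_const_mul]
  refine intervalIntegral.integral_mono_on hR
    ((hprim.mul (hcont.inv₀ fun _ => (Real.exp_pos _).ne')).intervalIntegrable _ _)
    (Continuous.intervalIntegrable (by fun_prop) _ _) fun s hs => ?_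
  rw [← integral_exp_two_mul_sub, ← intervalIntegral.integral_mul_const,
    ← intervalIntegral.integral_const_mul]
  refine intervalIntegral.integral_mono_on hs.1
    (Continuous.intervalIntegrable (by fun_prop) _ _)
    (Continuous.intervalIntegrable (by fun_prop) _ _) fun t ht => ?_
  rw [← Real.exp_neg, ← Real.exp_add, ← Real.exp_add]
  apply Real.exp_le_exp.2
  have h1 : s ^ 2 ≤ R ^ 2 := pow_le_pow_left₀ hs.1 hs.2 2
  have h2 : a * (s ^ 2 - t ^ 2) ≤ a * R ^ 2 :=
    mul_le_mul_of_nonneg_left (by linarith [sq_nonneg t]) ha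
  have h3 : q * (s - t) ≤ 1 * (s - t) := mul_le_mul_of_nonneg_right hq (by linarith [ht.2])
  linarith

theorem Qk_le_one (d : ℕ) (m b M β : ℝ) : Qk d m b M β ≤ 1 := by
  have h : √(kappa d m b M β - kappa d m b M β ^ 2) ≤ 1 / 2 :=
    Real.sqrt_le_iff.2 ⟨by norm_num, by nlinarith [sq_nonneg (kappa d m b M β - 1 / 2)]⟩
  unfold Qk
  linarith

theorem stmt7 (d : ℕ) (hd : 1 ≤ d) (m b M β : ℝ)
    (hm : 0 < m) (hb : 0 < b) (hM : 0 < M) (hβ : 0 < β) :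
    (0 < kappa d m b M β ∧ kappa d m b M β < 1) ∧
    (∫ s in (0:ℝ)..(R1 d m b β), Phi d m b M β s * (phi d m b M β s)⁻¹)
      ≤ 1 / (2 * Cc d m b β * β * kappa d m b M β) := by
  have hR := R1_pos hd hm hb hβ
  have hC : 0 < Cc d m b β := by
    unfold Cc
    positivity
  have hE : 0 < Real.exp (2 * R1 d m b β) - 1 - 2 * R1 d m b β := by
    have := Real.add_one_lt_exp (x := 2 * R1 d m b β) (by positivity)
    linarith
  have hκ : 0 < kappa d m b M β := lt_min (by norm_num) (by positivity)
  have hκ1 : kappa d m b M β ≤ 1 / 2 := min_le_left _ _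
  have hκ2 : kappa d m b M β ≤ 2 / (Cc d m b β * β *
      (Real.exp (2 * R1 d m b β) - 1 - 2 * R1 d m b β)) *
        Real.exp (-(M * β * R1 d m b β ^ 2 / 8)) := min_le_right _ _
  refine ⟨⟨hκ, by linarith⟩, ?_⟩
  refine (integral_primitive_mul_inv_le (a := M * β / 8) (by positivity)
    (Qk_le_one d m b M β) hR.le).trans ?_
  rw [Real.exp_neg, show M * β * R1 d m b β ^ 2 / 8 = M * β / 8 * R1 d m b β ^ 2 by ring,
    ← div_eq_mul_inv, div_div, le_div_iff₀ (by positivity)] at hκ2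
  rw [le_div_iff₀ (by positivity)]
  linarith

end
end

section
/- Let d ≥ 1 be an integer and m, b, β > 0, and let F, G ∈ C¹(ℝ^d;ℝ) be (m,b)-dissipative. If (x, y) ∈ ℝ^d × ℝ^d satisfies V̄₂(x) + V̄₂(y) > 4C(1 + 1/λ) (i.e. (x,y) ∉ S₂), then for every κ > 0, κ(−2⟨∇F(x), x⟩ + 2d/β) + κ(−2⟨∇G(y), y⟩ + 2d/β) ≤ −(λ/2) min{1, 4Cκ} (1 + κV̄₂(x) + κV̄₂(y)). (The left-hand side equals κℒ_F V̄₂(x) + κℒ_G V̄₂(y), where ℒ_H u := −⟨∇H, ∇u⟩ + β⁻¹Δu.) -/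
open MeasureTheory Real RealInnerProductSpace

noncomputable section

def Dissipative (d : ℕ) (m b : ℝ) (F : EuclideanSpace ℝ (Fin d) → ℝ) : Prop :=
  ∀ x, m * ‖x‖ ^ 2 - b ≤ ⟪gradient F x, x⟫

theorem stmt10 (d : ℕ) (hd : 1 ≤ d) (m b β : ℝ)
    (hm : 0 < m) (hb : 0 < b) (hβ : 0 < β)
    (F G : EuclideanSpace ℝ (Fin d) → ℝ)
    (hF : ContDiff ℝ 1 F) (hG : ContDiff ℝ 1 G)
    (hdF : Dissipative d m b F) (hdG : Dissipative d m b G)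
    (x y : EuclideanSpace ℝ (Fin d))
    (hxy : 4 * Cc d m b β * (1 + 1 / m) < Vbar x + Vbar y)
    (κ : ℝ) (hκ : 0 < κ) :
    κ * (-2 * ⟪gradient F x, x⟫ + 2 * (d : ℝ) / β) +
      κ * (-2 * ⟪gradient G y, y⟫ + 2 * (d : ℝ) / β) ≤
    -(m / 2) * min 1 (4 * Cc d m b β * κ) * (1 + κ * Vbar x + κ * Vbar y) := by
  have hVx : Vbar x = 1 + ‖x‖ ^ 2 := rfl
  have hVy : Vbar y = 1 + ‖y‖ ^ 2 := rfl
  have hC : Cc d m b β = 2 * ((d : ℝ) / β + b) + m := rfl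
  have hFx := hdF x
  have hGy := hdG y
  rw [mul_div_assoc]
  set C := Cc d m b β
  set S := Vbar x + Vbar y with hS
  have hmS : 4 * C * (m + 1) < m * S := by
    calc 4 * C * (m + 1) = m * (4 * C * (1 + 1 / m)) := by field_simp
      _ < m * S := by gcongr
  have hdrift : (-2 * ⟪gradient F x, x⟫ + 2 * ((d : ℝ) / β)) +
      (-2 * ⟪gradient G y, y⟫ + 2 * ((d : ℝ) / β)) ≤ -(m / 2) * (4 * C + S) := by
    have hx : 0 ≤ m * ‖x‖ ^ 2 := by positivity
    have hy : 0 ≤ m * ‖y‖ ^ 2 := by positivity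
    have hmS' : m * S = 2 * m + m * ‖x‖ ^ 2 + m * ‖y‖ ^ 2 := by rw [hS, hVx, hVy]; ring
    linarith
  have hκS : 0 ≤ κ * S := by rw [hS, hVx, hVy]; positivity
  have hmin : min 1 (4 * C * κ) * (1 + κ * S) ≤ 4 * C * κ + κ * S := by
    have := mul_le_mul_of_nonneg_right (min_le_left 1 (4 * C * κ)) hκS
    linarith [min_le_right 1 (4 * C * κ)]
  calc _ = κ * ((-2 * ⟪gradient F x, x⟫ + 2 * ((d : ℝ) / β)) +
        (-2 * ⟪gradient G y, y⟫ + 2 * ((d : ℝ) / β))) := by ring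
    _ ≤ κ * (-(m / 2) * (4 * C + S)) := by gcongr
    _ = -((m / 2) * (4 * C * κ + κ * S)) := by ring
    _ ≤ -((m / 2) * (min 1 (4 * C * κ) * (1 + κ * S))) := by gcongr
    _ = _ := by rw [hS]; ring

end
end

section
/- Let d ≥ 1 be an integer, m, b, β > 0, p ≥ 2, and let H ∈ C¹(ℝ^d;ℝ) be (m,b)-dissipative. Set λ(p) := mp/2, L(p) := ((2/m)((d + p − 2)/β + b))^{1/2}, and C(p) := λ(p) L(p)^p. Then for every x ∈ ℝ^d, −p‖x‖^{p−2}⟨∇H(x), x⟩ + β⁻¹ p(d + p − 2)‖x‖^{p−2} ≤ C(p) − λ(p)‖x‖^p. (The left-hand side equals ℒ_H V_p(x) := −⟨∇H(x), ∇V_p(x)⟩ + β⁻¹ΔV_p(x) for V_p(x) := ‖x‖^p, since ∇V_p(x) = p‖x‖^{p−2}x and ΔV_p(x) = p(d + p − 2)‖x‖^{p−2}.) -/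
open MeasureTheory Real RealInnerProductSpace

noncomputable section

theorem rpow_sub_two_mul_sq {r p : ℝ} (hr : 0 ≤ r) (hp : 2 ≤ p) :
    r ^ (p - 2) * r ^ 2 = r ^ p := by
  rw [← Real.rpow_two, ← Real.rpow_add_of_nonneg hr (by linarith) (by norm_num),
    sub_add_cancel]

theorem rpow_sub_two_mul_sq_le_add {r l p : ℝ} (hr : 0 ≤ r) (hl : 0 ≤ l) (hp : 2 ≤ p) :
    r ^ (p - 2) * l ^ 2 ≤ l ^ p + r ^ p := by
  rcases le_total r l with h | h
  · calc r ^ (p - 2) * l ^ 2 ≤ l ^ (p - 2) * l ^ 2 := by gcongr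
      _ = l ^ p := rpow_sub_two_mul_sq hl hp
      _ ≤ l ^ p + r ^ p := le_add_of_nonneg_right (by positivity)
  · calc r ^ (p - 2) * l ^ 2 ≤ r ^ (p - 2) * r ^ 2 := by gcongr
      _ = r ^ p := rpow_sub_two_mul_sq hr hp
      _ ≤ l ^ p + r ^ p := le_add_of_nonneg_left (by positivity)

theorem stmt11 (d : ℕ) (hd : 1 ≤ d) (m b β p : ℝ)
    (hm : 0 < m) (hb : 0 < b) (hβ : 0 < β) (hp : 2 ≤ p)
    (H : EuclideanSpace ℝ (Fin d) → ℝ)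
    (hH : ContDiff ℝ 1 H) (hdiss : Dissipative d m b H)
    (x : EuclideanSpace ℝ (Fin d)) :
    -p * ‖x‖ ^ (p - 2) * ⟪gradient H x, x⟫ + β⁻¹ * p * ((d : ℝ) + p - 2) * ‖x‖ ^ (p - 2)
      ≤ m * p / 2 * Real.sqrt (2 / m * (((d : ℝ) + p - 2) / β + b)) ^ p
        - m * p / 2 * ‖x‖ ^ p := by
  have hd' : (1 : ℝ) ≤ d := by exact_mod_cast hd
  have hK : 0 ≤ ((d : ℝ) + p - 2) / β := div_nonneg (by linarith) hβ.le
  have hL2 : Real.sqrt (2 / m * (((d : ℝ) + p - 2) / β + b)) ^ 2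
      = 2 / m * (((d : ℝ) + p - 2) / β + b) := Real.sq_sqrt (by positivity)
  set L := Real.sqrt (2 / m * (((d : ℝ) + p - 2) / β + b))
  have hKb : β⁻¹ * ((d : ℝ) + p - 2) = m / 2 * L ^ 2 - b := by
    rw [hL2]
    field_simp
    ring
  have hL : 0 ≤ L := Real.sqrt_nonneg _
  have hp0 : 0 ≤ p := by linarith
  have hx := rpow_sub_two_mul_sq (norm_nonneg x) hp
  have hyoung := rpow_sub_two_mul_sq_le_add (norm_nonneg x) hL hp
  calc -p * ‖x‖ ^ (p - 2) * ⟪gradient H x, x⟫ + β⁻¹ * p * ((d : ℝ) + p - 2) * ‖x‖ ^ (p - 2)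
      = p * ‖x‖ ^ (p - 2) * (β⁻¹ * ((d : ℝ) + p - 2) - ⟪gradient H x, x⟫) := by ring
    _ ≤ p * ‖x‖ ^ (p - 2) * (β⁻¹ * ((d : ℝ) + p - 2) - (m * ‖x‖ ^ 2 - b)) := by
        gcongr
        exact hdiss x
    _ = m * p / 2 * (‖x‖ ^ (p - 2) * L ^ 2 - 2 * (‖x‖ ^ (p - 2) * ‖x‖ ^ 2)) := by
        rw [hKb]
        ring
    _ ≤ m * p / 2 * (L ^ p - ‖x‖ ^ p) := by
        rw [hx]
        exact mul_le_mul_of_nonneg_left (by linarith) (by positivity)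
    _ = m * p / 2 * L ^ p - m * p / 2 * ‖x‖ ^ p := by ring

end
end

section
/- Let n ≥ 2 and 1 ≤ B ≤ n be integers, M, A > 0, and let ℓ₁, …, ℓ_n ∈ C¹(ℝ^d;ℝ) satisfy ‖∇ℓ_i(0)‖ ≤ A and ‖∇ℓ_i(x) − ∇ℓ_i(y)‖ ≤ M‖x − y‖ for all i and all x, y ∈ ℝ^d. Let I be a uniformly distributed random subset of {1, …, n} of cardinality B, let L_n(w) := (1/n)Σ_{i=1}^n ℓ_i(w) and L_I(w) := (1/B)Σ_{i∈I} ℓ_i(w). Then for every w ∈ ℝ^d, E[‖∇L_n(w) − ∇L_I(w)‖²] ≤ (4(n − B)/(B(n − 1))) (M‖w‖ + A)². -/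
open MeasureTheory Real RealInnerProductSpace

noncomputable section

section Gradient

variable {F ι : Type*} [NormedAddCommGroup F] [InnerProductSpace ℝ F] [CompleteSpace F]

theorem gradient_const_mul_sum {f : ι → F → ℝ} {x : F} (hf : ∀ i, DifferentiableAt ℝ (f i) x)
    (c : ℝ) (s : Finset ι) :
    gradient (fun v => c * ∑ i ∈ s, f i v) x = c • ∑ i ∈ s, gradient (f i) x := by
  apply HasGradientAt.gradient
  rw [hasGradientAt_iff_hasFDerivAt, map_smul, map_sum]
  exact (HasFDerivAt.fun_sum fun i _ => (hf i).hasGradientAt.hasFDerivAt).const_mul c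

end Gradient

section Sampling

variable {ι : Type*} [Fintype ι] [DecidableEq ι]

theorem card_filter_mem_notMem_powersetCard {i j : ι} (hij : i ≠ j) {k : ℕ} (hk : 1 ≤ k) :
    ((Finset.powersetCard k (Finset.univ : Finset ι)).filter
      fun I => i ∈ I ∧ j ∉ I).card = (Fintype.card ι - 2).choose (k - 1) := by
  have h : (Finset.powersetCard k (Finset.univ : Finset ι)).filter (fun I => i ∈ I ∧ j ∉ I) =
      (Finset.powersetCard k (Finset.univ.erase j)).filter fun I => {i} ⊆ I := by
    ext I
    simp only [Finset.mem_filter, Finset.mem_powersetCard, Finset.singleton_subset_iff,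
      Finset.subset_erase, Finset.subset_univ, true_and]
    tauto
  rw [h, Finset.card_filter_powersetCard_subset _ _ _ (by simpa using hij) (by simpa using hk)]
  simp [Nat.sub_sub]

variable {F : Type*} [NormedAddCommGroup F] [InnerProductSpace ℝ F]

theorem sum_powersetCard_norm_sum_sq {h : ι → F} (hh : ∑ i, h i = 0) {k : ℕ} (hk : 1 ≤ k) :
    ∑ I ∈ Finset.powersetCard k (Finset.univ : Finset ι), ‖∑ i ∈ I, h i‖ ^ 2 =
      ((Fintype.card ι - 2).choose (k - 1) : ℝ) * ∑ i, ‖h i‖ ^ 2 := by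
  have hI (I : Finset ι) : ‖∑ i ∈ I, h i‖ ^ 2 =
      -∑ i, ∑ j, if i ∈ I ∧ j ∉ I then ⟪h i, h j⟫ else 0 := by
    have hc : ∑ i ∈ I, h i = -∑ j ∈ Iᶜ, h j :=
      eq_neg_of_add_eq_zero_left ((Finset.sum_add_sum_compl I h).trans hh)
    rw [← real_inner_self_eq_norm_sq]
    nth_rw 2 [hc]
    rw [inner_neg_right, sum_inner]
    have hfilter : Iᶜ = Finset.univ.filter (· ∉ I) := by ext; simp
    simp [hfilter, inner_sum, ite_and, Finset.sum_filter, apply_ite (inner ℝ _)]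
  have hij (i j : ι) : (∑ I ∈ Finset.powersetCard k (Finset.univ : Finset ι),
      if i ∈ I ∧ j ∉ I then ⟪h i, h j⟫ else 0) =
      ((Fintype.card ι - 2).choose (k - 1) : ℝ) * if i = j then 0 else ⟪h i, h j⟫ := by
    rw [← Finset.sum_filter, Finset.sum_const, nsmul_eq_mul]
    split_ifs with e
    · subst e; simp
    · rw [card_filter_mem_notMem_powersetCard e hk]
  have hi (i : ι) : (∑ j, if i = j then 0 else ⟪h i, h j⟫) = -‖h i‖ ^ 2 := by
    have h1 (j : ι) : (if i = j then 0 else ⟪h i, h j⟫) =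
        ⟪h i, h j⟫ - if i = j then ⟪h i, h j⟫ else 0 := by split_ifs <;> simp
    simp [h1, ← inner_sum, hh]
  simp_rw [hI]
  rw [Finset.sum_neg_distrib, Finset.sum_comm]
  simp_rw [Finset.sum_comm (s := Finset.powersetCard k Finset.univ) (t := Finset.univ), hij,
    ← Finset.mul_sum, hi]
  simp

end Sampling

theorem choose_sub_two_mul {n k : ℕ} (hn : 2 ≤ n) (hk : 1 ≤ k) (hkn : k ≤ n) :
    ((n - 2).choose (k - 1) : ℝ) * (n * (n - 1)) = k * (n - k) * n.choose k := by
  obtain ⟨m, rfl⟩ := Nat.exists_eq_add_of_le' hn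
  obtain ⟨b, rfl⟩ := Nat.exists_eq_add_of_le' hk
  have h1 := congrArg (Nat.cast (R := ℝ)) (Nat.choose_mul_succ_eq m b)
  have h2 := congrArg (Nat.cast (R := ℝ)) (Nat.add_one_mul_choose_eq (m + 1) b)
  push_cast [Nat.cast_sub (show b ≤ m + 1 by omega)] at h1 h2
  simp only [Nat.add_sub_cancel]
  push_cast
  linear_combination (m + 2 : ℝ) * h1 + (m + 1 - b : ℝ) * h2

theorem stmt12 (d n B : ℕ) (hd : 1 ≤ d) (hn : 2 ≤ n) (hB1 : 1 ≤ B) (hBn : B ≤ n)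
    (M A : ℝ) (hM : 0 < M) (hA : 0 < A)
    (ℓ : Fin n → EuclideanSpace ℝ (Fin d) → ℝ)
    (hC1 : ∀ i, ContDiff ℝ 1 (ℓ i))
    (h0 : ∀ i, ‖gradient (ℓ i) 0‖ ≤ A)
    (hsm : ∀ i x y, ‖gradient (ℓ i) x - gradient (ℓ i) y‖ ≤ M * ‖x - y‖)
    (w : EuclideanSpace ℝ (Fin d)) :
    (1 / (n.choose B : ℝ)) *
      ∑ I ∈ Finset.powersetCard B (Finset.univ : Finset (Fin n)),
        ‖gradient (fun v => (1 / (n : ℝ)) * ∑ i, ℓ i v) w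
          - gradient (fun v => (1 / (B : ℝ)) * ∑ i ∈ I, ℓ i v) w‖ ^ 2
      ≤ 4 * ((n : ℝ) - B) / (B * ((n : ℝ) - 1)) * (M * ‖w‖ + A) ^ 2 := by
  have hdiff (i : Fin n) : DifferentiableAt ℝ (ℓ i) w :=
    (hC1 i).differentiable one_ne_zero w
  have hn0 : (0 : ℝ) < n := by exact_mod_cast (by omega : 0 < n)
  have hn1 : (0 : ℝ) < n - 1 := sub_pos.2 (by exact_mod_cast (by omega : 1 < n))
  have hB0 : (0 : ℝ) < B := by exact_mod_cast hB1
  have hnB : (0 : ℝ) ≤ n - B := sub_nonneg.2 (by exact_mod_cast hBn)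
  have hC : (0 : ℝ) < n.choose B := by exact_mod_cast Nat.choose_pos hBn
  simp_rw [gradient_const_mul_sum hdiff]
  set K := M * ‖w‖ + A
  set g : Fin n → EuclideanSpace ℝ (Fin d) := fun i => gradient (ℓ i) w
  set m := (1 / (n : ℝ)) • ∑ i, g i with hm
  have hgK (i : Fin n) : ‖g i‖ ≤ K := by
    have h1 := hsm i w 0
    rw [sub_zero] at h1
    have h2 := norm_le_norm_add_norm_sub' (g i) (gradient (ℓ i) 0)
    linarith [h0 i]
  have hmK : ‖m‖ ≤ K := by
    rw [hm, norm_smul, Real.norm_of_nonneg (by positivity), one_div, inv_mul_le_iff₀ hn0]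
    simpa using norm_sum_le_of_le Finset.univ fun i _ => hgK i
  have hsum : ∑ i, (g i - m) = 0 := by
    simp [hm, smul_smul, Finset.sum_sub_distrib, ← Nat.cast_smul_eq_nsmul ℝ, hn0.ne']
  have hterm : ∀ I ∈ Finset.powersetCard B (Finset.univ : Finset (Fin n)),
      ‖m - (1 / (B : ℝ)) • ∑ i ∈ I, g i‖ ^ 2 = (1 / (B : ℝ)) ^ 2 * ‖∑ i ∈ I, (g i - m)‖ ^ 2 := by
    intro I hI
    have : m - (1 / (B : ℝ)) • ∑ i ∈ I, g i = -((1 / (B : ℝ)) • ∑ i ∈ I, (g i - m)) := by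
      simp [Finset.sum_sub_distrib, (Finset.mem_powersetCard.1 hI).2,
        ← Nat.cast_smul_eq_nsmul ℝ, smul_sub, smul_smul, hB0.ne']
    rw [this, norm_neg, norm_smul, mul_pow, Real.norm_eq_abs, sq_abs]
  have hbound : ∑ i, ‖g i - m‖ ^ 2 ≤ n * (2 * K) ^ 2 := by
    have h1 (i : Fin n) : ‖g i - m‖ ^ 2 ≤ (2 * K) ^ 2 := by
      gcongr
      linarith [norm_sub_le (g i) m, hgK i]
    simpa using Finset.sum_le_sum fun i (_ : i ∈ Finset.univ) => h1 i
  rw [Finset.sum_congr rfl hterm, ← Finset.mul_sum, sum_powersetCard_norm_sum_sq hsum hB1,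
    Fintype.card_fin]
  have hcoef : ((n - 2).choose (B - 1) : ℝ) = B * (n - B) * n.choose B / (n * (n - 1)) := by
    rw [eq_div_iff (by positivity), choose_sub_two_mul hn hB1 hBn]
  rw [hcoef]
  calc _ = (n - B) / (B * n * (n - 1)) * ∑ i, ‖g i - m‖ ^ 2 := by field_simp
    _ ≤ (n - B) / (B * n * (n - 1)) * (n * (2 * K) ^ 2) := by gcongr
    _ = _ := by field_simp; ring

end
end
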